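/- Let T be a Hopf algebra over a field k, N a left T-module bialgebra via μ: T⊗N → N, t⊗n ↦ t(n), A a commutative k-algebra, and (M,θ) a universal measuring coalgebra of N to A with its Hopf algebra structure uniquely determined by θ(fg⊗n) = ∑ θ(f⊗n_(1)) θ(g⊗n_(2)). Then there is a unique coalgebra map μ̄: M⊗T → M, written f⊗t ↦ f^t, such that θ(f^t⊗n) = θ(f⊗t(n)) for all f ∈ M, t ∈ T, n ∈ N; and μ̄ is a right T-module structure making M a right T-module bialgebra (in particular (fg)^t = ∑ f^{t_(1)} g^{t_(2)} and 1^t = ε(t)1). -/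

import Mathlib

open TensorProduct

namespace SmashPaper

variable (k : Type) [Field k]

section Conv

variable {k : Type} [Field k] {C A : Type} [AddCommGroup C] [Module k C] [Coalgebra k C]
  [CommRing A] [Algebra k A]

/-- Convolution product on linear maps from a coalgebra to an algebra. -/
noncomputable def conv (f g : C →ₗ[k] A) : C →ₗ[k] A :=
  LinearMap.mul' k A ∘ₗ TensorProduct.map f g ∘ₗ Coalgebra.comul

/-- Convolution unit. -/
noncomputable def convOne (C A : Type) [AddCommGroup C] [Module k C] [Coalgebra k C]
    [CommRing A] [Algebra k A] : C →ₗ[k] A :=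
  Algebra.linearMap k A ∘ₗ Coalgebra.counit

def IsConvInv (f g : C →ₗ[k] A) : Prop :=
  conv f g = convOne C A ∧ conv g f = convOne C A

def IsConvInvertible (f : C →ₗ[k] A) : Prop := ∃ g, IsConvInv f g

end Conv

/-- Cocommutativity of a coalgebra. -/
def IsCocomm (C : Type) [AddCommGroup C] [Module k C] [Coalgebra k C] : Prop :=
  (TensorProduct.comm k C C).toLinearMap ∘ₗ Coalgebra.comul
    = (Coalgebra.comul : C →ₗ[k] C ⊗[k] C)

section Drop

variable {k : Type} [Field k] (C D : Type) [AddCommGroup C] [Module k C]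
  [AddCommGroup D] [Module k D]

/-- `c ⊗ d ↦ ε(c) d`. -/
noncomputable def dropL [Coalgebra k C] : C ⊗[k] D →ₗ[k] D :=
  (TensorProduct.lid k D).toLinearMap ∘ₗ LinearMap.rTensor D (Coalgebra.counit (R := k))

/-- `c ⊗ d ↦ ε(d) c`. -/
noncomputable def dropR [Coalgebra k D] : C ⊗[k] D →ₗ[k] C :=
  (TensorProduct.rid k C).toLinearMap ∘ₗ LinearMap.lTensor C (Coalgebra.counit (R := k))

end Drop

section Sweedler

variable {k : Type} [Field k] (H A : Type) [Ring H] [Bialgebra k H]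
  [CommRing A] [Algebra k A]

variable {H A}

/-- Normalization for 1-cochains. -/
def Normalized1 (t : H →ₗ[k] A) : Prop := t 1 = 1

/-- Normalization for 2-cochains: trivial whenever an argument is a scalar. -/
def Normalized2 (f : H ⊗[k] H →ₗ[k] A) : Prop :=
  ∀ x : H, f (1 ⊗ₜ[k] x) = algebraMap k A (Coalgebra.counit x)
    ∧ f (x ⊗ₜ[k] 1) = algebraMap k A (Coalgebra.counit x)

/-- Normalization for 3-cochains. -/
def Normalized3 (f : (H ⊗[k] H) ⊗[k] H →ₗ[k] A) : Prop :=
  ∀ x y : H,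
    f ((1 ⊗ₜ[k] x) ⊗ₜ[k] y) = algebraMap k A (Coalgebra.counit x * Coalgebra.counit y)
    ∧ f ((x ⊗ₜ[k] 1) ⊗ₜ[k] y) = algebraMap k A (Coalgebra.counit x * Coalgebra.counit y)
    ∧ f ((x ⊗ₜ[k] y) ⊗ₜ[k] 1) = algebraMap k A (Coalgebra.counit x * Coalgebra.counit y)

/-- `∑ f(x₍₁₎ ⊗ y₍₁₎) f(x₍₂₎y₍₂₎ ⊗ z)` as a linear map on `(H ⊗ H) ⊗ H`. -/
noncomputable def cocycle2LHS (f : H ⊗[k] H →ₗ[k] A) : (H ⊗[k] H) ⊗[k] H →ₗ[k] A :=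
  conv (f ∘ₗ dropR (H ⊗[k] H) H) (f ∘ₗ LinearMap.rTensor H (LinearMap.mul' k H))

/-- `∑ f(y₍₁₎ ⊗ z₍₁₎) f(x ⊗ y₍₂₎z₍₂₎)` as a linear map on `(H ⊗ H) ⊗ H`. -/
noncomputable def cocycle2RHS (f : H ⊗[k] H →ₗ[k] A) : (H ⊗[k] H) ⊗[k] H →ₗ[k] A :=
  conv (f ∘ₗ dropL H (H ⊗[k] H) ∘ₗ (TensorProduct.assoc k H H H).toLinearMap)
       (f ∘ₗ LinearMap.lTensor H (LinearMap.mul' k H) ∘ₗ (TensorProduct.assoc k H H H).toLinearMap)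

/-- Sweedler 2-cocycles (for the trivial action). -/
def IsZ2 (f : H ⊗[k] H →ₗ[k] A) : Prop :=
  Normalized2 f ∧ IsConvInvertible f ∧ cocycle2LHS f = cocycle2RHS f

/-- The Sweedler 2-coboundary `∑ t(y₍₁₎) t⁻¹(x₍₁₎y₍₂₎) t(x₍₂₎)` of a 1-cochain `t`
with convolution inverse `tinv`. -/
noncomputable def cobound2 (t tinv : H →ₗ[k] A) : H ⊗[k] H →ₗ[k] A :=
  conv (t ∘ₗ dropL H H) (conv (tinv ∘ₗ LinearMap.mul' k H) (t ∘ₗ dropR H H))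

/-- Sweedler 2-coboundaries (for the trivial action). -/
def IsB2 (f : H ⊗[k] H →ₗ[k] A) : Prop :=
  ∃ t tinv : H →ₗ[k] A, Normalized1 t ∧ IsConvInv t tinv ∧ f = cobound2 t tinv

/-- Two 2-cochains are cohomologous when they differ (in convolution) by a 2-coboundary. -/
def Cohomologous2 (f f' : H ⊗[k] H →ₗ[k] A) : Prop :=
  ∃ b, IsB2 b ∧ f = conv f' b

/-- `(x⊗y)⊗z ↦ x ⊗ yz`. -/
noncomputable def m23 : (H ⊗[k] H) ⊗[k] H →ₗ[k] H ⊗[k] H :=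
  LinearMap.lTensor H (LinearMap.mul' k H) ∘ₗ (TensorProduct.assoc k H H H).toLinearMap

/-- `(x⊗y)⊗z ↦ ε(x) (y⊗z)`. -/
noncomputable def p23 : (H ⊗[k] H) ⊗[k] H →ₗ[k] H ⊗[k] H :=
  dropL H (H ⊗[k] H) ∘ₗ (TensorProduct.assoc k H H H).toLinearMap

/-- 3-cocycle condition
`∑ f(y₁⊗z₁⊗w₁) f(x₁⊗y₂z₂⊗w₂) f(x₂⊗y₃⊗z₃) = ∑ f(x₁y₁⊗z₁⊗w₁) f(x₂⊗y₂⊗z₂w₂)`. -/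
def IsZ3cond (f : (H ⊗[k] H) ⊗[k] H →ₗ[k] A) : Prop :=
  conv (f ∘ₗ LinearMap.rTensor H (LinearMap.rTensor H (dropL H H)))
    (conv (f ∘ₗ LinearMap.rTensor H (m23 (H := H)))
          (f ∘ₗ dropR ((H ⊗[k] H) ⊗[k] H) H))
  = conv (C := ((H ⊗[k] H) ⊗[k] H) ⊗[k] H)
         (f ∘ₗ LinearMap.rTensor H (LinearMap.rTensor H (LinearMap.mul' k H)))
         (f ∘ₗ (LinearMap.lTensor (H ⊗[k] H) (LinearMap.mul' k H)
              ∘ₗ (TensorProduct.assoc k (H ⊗[k] H) H H).toLinearMap :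
                ((H ⊗[k] H) ⊗[k] H) ⊗[k] H →ₗ[k] (H ⊗[k] H) ⊗[k] H))

/-- Sweedler 3-cocycles (for the trivial action). -/
def IsZ3 (f : (H ⊗[k] H) ⊗[k] H →ₗ[k] A) : Prop :=
  Normalized3 f ∧ IsConvInvertible f ∧ IsZ3cond f

/-- The Sweedler 3-coboundary
`∑ v(y₁⊗z₁) v⁻¹(x₁y₂⊗z₂) v(x₂⊗y₃z₃) v⁻¹(x₃⊗y₄)` of a 2-cochain `v`. -/
noncomputable def cobound3 (v vinv : H ⊗[k] H →ₗ[k] A) : (H ⊗[k] H) ⊗[k] H →ₗ[k] A :=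
  conv (v ∘ₗ p23 (H := H))
    (conv (vinv ∘ₗ LinearMap.rTensor H (LinearMap.mul' k H))
      (conv (v ∘ₗ m23 (H := H)) (vinv ∘ₗ dropR (H ⊗[k] H) H)))

/-- Sweedler 3-coboundaries (for the trivial action). -/
def IsB3 (f : (H ⊗[k] H) ⊗[k] H →ₗ[k] A) : Prop :=
  ∃ v vinv : H ⊗[k] H →ₗ[k] A, Normalized2 v ∧ IsConvInv v vinv ∧ f = cobound3 v vinv

/-- Cohomologous 3-cochains. -/
def Cohomologous3 (f f' : (H ⊗[k] H) ⊗[k] H →ₗ[k] A) : Prop :=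
  ∃ b, IsB3 b ∧ f = conv f' b

end Sweedler

section Measuring

variable {k : Type} [Field k]
variable {C : Type} [AddCommGroup C] [Module k C] [Coalgebra k C]
variable {N : Type} [Ring N] [Bialgebra k N]
variable {A : Type} [CommRing A] [Algebra k A]

/-- `(C, θ)` measures `N` to `A`:
`∑ θ(c₍₁₎ ⊗ n) θ(c₍₂₎ ⊗ n') = θ(c ⊗ nn')` and `θ(c ⊗ 1) = ε(c) 1`. -/
def Measures (θ : C ⊗[k] N →ₗ[k] A) : Prop :=
  (θ ∘ₗ LinearMap.lTensor C (LinearMap.mul' k N)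
    = conv (θ ∘ₗ LinearMap.lTensor C (dropR N N)) (θ ∘ₗ LinearMap.lTensor C (dropL N N)))
  ∧ ∀ c : C, θ (c ⊗ₜ[k] (1 : N)) = algebraMap k A (Coalgebra.counit c)

end Measuring

section Action

variable {k : Type} [Field k]
variable {T N : Type} [Ring T] [Bialgebra k T] [Ring N] [Bialgebra k N]

/-- `μ : T ⊗ N → N` makes `N` a left `T`-module bialgebra. -/
structure IsModuleBialgebra (μ : T ⊗[k] N →ₗ[k] N) : Prop where
  one_act : ∀ n : N, μ ((1 : T) ⊗ₜ[k] n) = n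
  mul_act : ∀ (t s : T) (n : N), μ ((t * s) ⊗ₜ[k] n) = μ (t ⊗ₜ[k] μ (s ⊗ₜ[k] n))
  act_one : ∀ t : T, μ (t ⊗ₜ[k] (1 : N)) = algebraMap k N (Coalgebra.counit t)
  act_mul : μ ∘ₗ LinearMap.lTensor T (LinearMap.mul' k N)
      = LinearMap.mul' k N ∘ₗ TensorProduct.map μ μ
          ∘ₗ (TensorProduct.tensorTensorTensorComm k T T N N).toLinearMap
          ∘ₗ LinearMap.rTensor (N ⊗[k] N) Coalgebra.comul
  comul_act : Coalgebra.comul ∘ₗ μ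
      = TensorProduct.map μ μ
          ∘ₗ (TensorProduct.tensorTensorTensorComm k T T N N).toLinearMap
          ∘ₗ TensorProduct.map Coalgebra.comul Coalgebra.comul
  counit_act : ∀ (t : T) (n : N),
      Coalgebra.counit (R := k) (μ (t ⊗ₜ[k] n))
        = Coalgebra.counit (R := k) t * Coalgebra.counit (R := k) n

/-- `t ⊗ n ↦ ∑ t₍₁₎(n) ⊗ t₍₂₎`. -/
noncomputable def smashCross (μ : T ⊗[k] N →ₗ[k] N) : T ⊗[k] N →ₗ[k] N ⊗[k] T :=
  TensorProduct.map μ LinearMap.id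
    ∘ₗ (TensorProduct.assoc k T N T).symm.toLinearMap
    ∘ₗ LinearMap.lTensor T (TensorProduct.comm k T N).toLinearMap
    ∘ₗ (TensorProduct.assoc k T T N).toLinearMap
    ∘ₗ LinearMap.rTensor N Coalgebra.comul

variable {H : Type} [Ring H] [Bialgebra k H]

/-- `H` is the smash product `N ⋊ T` along the action `μ`, with `N` and `T` included
as the Hopf subalgebras `N ⋊ 1` and `1 ⋊ T`; we identify `n ⋊ t = n t`. -/
structure IsSmashProduct (μ : T ⊗[k] N →ₗ[k] N) (iN : N →ₐc[k] H) (iT : T →ₐc[k] H) : Prop where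
  act : IsModuleBialgebra μ
  injN : Function.Injective iN
  injT : Function.Injective iT
  /-- `n ⊗ t ↦ (n ⋊ 1)(1 ⋊ t)` is a linear isomorphism `N ⊗ T ≅ H` (`H` is the
  tensor product coalgebra `N ⊗ T`). -/
  bij : Function.Bijective
    (LinearMap.mul' k H ∘ₗ TensorProduct.map (iN : N →ₗ[k] H) (iT : T →ₗ[k] H))
  /-- The smash relation `t n = ∑ t₍₁₎(n) t₍₂₎` in `H`. -/
  straighten : LinearMap.mul' k H ∘ₗ TensorProduct.map (iT : T →ₗ[k] H) (iN : N →ₗ[k] H)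
      = LinearMap.mul' k H ∘ₗ TensorProduct.map (iN : N →ₗ[k] H) (iT : T →ₗ[k] H)
          ∘ₗ smashCross μ

end Action

section MeasCohomology

variable {k : Type} [Field k]
variable {T N : Type} [Ring T] [Bialgebra k T] [Ring N] [Bialgebra k N]
variable {A : Type} [CommRing A] [Algebra k A]

/-- Normalization in the `T`-variable for measuring 1-cochains `T ⊗ N → A`. -/
def MeasNormalized1 (f : T ⊗[k] N →ₗ[k] A) : Prop :=
  ∀ n : N, f ((1 : T) ⊗ₜ[k] n) = algebraMap k A (Coalgebra.counit n)

/-- A measuring 1-cochain: an element of `Reg_meas(T, Hom(N,A))`. -/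
def IsRegMeas1 (f : T ⊗[k] N →ₗ[k] A) : Prop :=
  Measures f ∧ MeasNormalized1 f ∧ IsConvInvertible f

/-- The measuring 1-cocycle condition `f(ts)(n) = ∑ f(s₍₁₎)(n₍₁₎) f(t)(s₍₂₎(n₍₂₎))`. -/
def MeasCocycle1 (μ : T ⊗[k] N →ₗ[k] N) (f : T ⊗[k] N →ₗ[k] A) : Prop :=
  f ∘ₗ LinearMap.rTensor N (LinearMap.mul' k T)
    = conv (f ∘ₗ LinearMap.rTensor N (dropL T T))
      (f ∘ₗ LinearMap.lTensor T μ ∘ₗ (TensorProduct.assoc k T T N).toLinearMap)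

/-- Measuring 1-cocycles. -/
def IsMeasZ1 (μ : T ⊗[k] N →ₗ[k] N) (f : T ⊗[k] N →ₗ[k] A) : Prop :=
  IsRegMeas1 f ∧ MeasCocycle1 μ f

/-- Measuring 1-coboundaries: `f(t)(n) = ∑ g(n₍₁₎) g⁻¹(t(n₍₂₎))` for a
convolution-invertible algebra map `g : N → A`. -/
def IsMeasB1 (μ : T ⊗[k] N →ₗ[k] N) (f : T ⊗[k] N →ₗ[k] A) : Prop :=
  ∃ (g : N →ₐ[k] A) (ginv : N →ₗ[k] A), IsConvInv g.toLinearMap ginv ∧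
    f = conv (g.toLinearMap ∘ₗ dropL T N) (ginv ∘ₗ μ)

/-- Normalization for measuring 2-cochains `(T ⊗ T) ⊗ N → A`. -/
def MeasNormalized2 (f : (T ⊗[k] T) ⊗[k] N →ₗ[k] A) : Prop :=
  ∀ (t : T) (n : N),
    f (((1 : T) ⊗ₜ[k] t) ⊗ₜ[k] n)
        = algebraMap k A (Coalgebra.counit t * Coalgebra.counit n)
    ∧ f ((t ⊗ₜ[k] (1 : T)) ⊗ₜ[k] n)
        = algebraMap k A (Coalgebra.counit t * Coalgebra.counit n)

/-- A measuring 2-cochain: an element of `Reg_meas(T ⊗ T, Hom(N,A))`. -/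
def IsRegMeas2 (f : (T ⊗[k] T) ⊗[k] N →ₗ[k] A) : Prop :=
  Measures f ∧ MeasNormalized2 f ∧ IsConvInvertible f

/-- The measuring 2-cocycle condition
`∑ f(t₍₁₎⊗s₍₁₎)(r₍₁₎(n₍₁₎)) f(t₍₂₎s₍₂₎⊗r₍₂₎)(n₍₂₎) = ∑ f(s₍₁₎⊗r₍₁₎)(n₍₁₎) f(t⊗s₍₂₎r₍₂₎)(n₍₂₎)`. -/
def MeasCocycle2 (μ : T ⊗[k] N →ₗ[k] N) (f : (T ⊗[k] T) ⊗[k] N →ₗ[k] A) : Prop :=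
  conv (C := ((T ⊗[k] T) ⊗[k] T) ⊗[k] N)
       (f ∘ₗ (LinearMap.lTensor (T ⊗[k] T) μ
          ∘ₗ (TensorProduct.assoc k (T ⊗[k] T) T N).toLinearMap :
            ((T ⊗[k] T) ⊗[k] T) ⊗[k] N →ₗ[k] (T ⊗[k] T) ⊗[k] N))
       (f ∘ₗ LinearMap.rTensor N (LinearMap.rTensor T (LinearMap.mul' k T)))
    = conv (C := ((T ⊗[k] T) ⊗[k] T) ⊗[k] N)
           (f ∘ₗ LinearMap.rTensor N (LinearMap.rTensor T (dropL T T)))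
           (f ∘ₗ LinearMap.rTensor N
              ((LinearMap.lTensor T (LinearMap.mul' k T)
                ∘ₗ (TensorProduct.assoc k T T T).toLinearMap :
                  (T ⊗[k] T) ⊗[k] T →ₗ[k] T ⊗[k] T)))

/-- Measuring 2-cocycles. -/
def IsMeasZ2 (μ : T ⊗[k] N →ₗ[k] N) (f : (T ⊗[k] T) ⊗[k] N →ₗ[k] A) : Prop :=
  IsRegMeas2 f ∧ MeasCocycle2 μ f

/-- The measuring coboundary
`(t ⊗ s ⊗ n) ↦ ∑ g(s₍₁₎)(n₍₁₎) g⁻¹(t₍₁₎s₍₂₎)(n₍₂₎) g(t₍₂₎)(s₍₃₎(n₍₃₎))`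
of a 1-cochain `g` with convolution inverse `ginv`.  (For a 2-cocycle `f` on `N` with
stability witness `g`, this same formula is the map `d`. ) -/
noncomputable def measCobound (μ : T ⊗[k] N →ₗ[k] N) (g ginv : T ⊗[k] N →ₗ[k] A) :
    (T ⊗[k] T) ⊗[k] N →ₗ[k] A :=
  conv (g ∘ₗ LinearMap.rTensor N (dropL T T))
    (conv (ginv ∘ₗ LinearMap.rTensor N (LinearMap.mul' k T))
          (g ∘ₗ LinearMap.lTensor T μ ∘ₗ (TensorProduct.assoc k T T N).toLinearMap))

/-- Measuring 2-coboundaries. -/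
def IsMeasB2 (μ : T ⊗[k] N →ₗ[k] N) (f : (T ⊗[k] T) ⊗[k] N →ₗ[k] A) : Prop :=
  ∃ g ginv : T ⊗[k] N →ₗ[k] A, IsRegMeas1 g ∧ IsConvInv g ginv ∧ f = measCobound μ g ginv

/-- Cohomologous measuring 2-cochains. -/
def MeasCohomologous2 (μ : T ⊗[k] N →ₗ[k] N) (f f' : (T ⊗[k] T) ⊗[k] N →ₗ[k] A) : Prop :=
  ∃ b, IsMeasB2 μ b ∧ f = conv f' b

/-- `∑ f(n₍₁₎ ⊗ n'₍₁₎) f⁻¹(t₍₁₎(n₍₂₎) ⊗ t₍₂₎(n'₍₂₎))` as a map `T ⊗ (N ⊗ N) → A`. -/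
noncomputable def stabLHS (μ : T ⊗[k] N →ₗ[k] N) (f finv : N ⊗[k] N →ₗ[k] A) :
    T ⊗[k] (N ⊗[k] N) →ₗ[k] A :=
  conv (f ∘ₗ dropL T (N ⊗[k] N))
       (finv ∘ₗ TensorProduct.map μ μ
          ∘ₗ (TensorProduct.tensorTensorTensorComm k T T N N).toLinearMap
          ∘ₗ LinearMap.rTensor (N ⊗[k] N) Coalgebra.comul)

/-- `∑ g(t₍₁₎ ⊗ n₍₁₎) g⁻¹(t₍₂₎ ⊗ n₍₂₎n'₍₁₎) g(t₍₃₎ ⊗ n'₍₂₎)` as a map `T ⊗ (N ⊗ N) → A`. -/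
noncomputable def stabRHS (g ginv : T ⊗[k] N →ₗ[k] A) : T ⊗[k] (N ⊗[k] N) →ₗ[k] A :=
  conv (g ∘ₗ LinearMap.lTensor T (dropR N N))
    (conv (ginv ∘ₗ LinearMap.lTensor T (LinearMap.mul' k N))
          (g ∘ₗ LinearMap.lTensor T (dropL N N)))

/-- `g` (with convolution inverse `ginv`) witnesses the `T`-stability of the
2-cochain `f` on `N` (with convolution inverse `finv`):
`f * (f⁻¹)ᵗ = δ'(g(t ⊗ _))`. -/
def IsStabilityWitness (μ : T ⊗[k] N →ₗ[k] N) (f finv : N ⊗[k] N →ₗ[k] A)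
    (g ginv : T ⊗[k] N →ₗ[k] A) : Prop :=
  MeasNormalized1 g ∧ (∀ t : T, g (t ⊗ₜ[k] (1 : N)) = algebraMap k A (Coalgebra.counit t))
    ∧ IsConvInv g ginv ∧ stabLHS μ f finv = stabRHS g ginv

/-- The cohomology class of the 2-cocycle `f` on `N` is `T`-stable. -/
def IsTStable (μ : T ⊗[k] N →ₗ[k] N) (f finv : N ⊗[k] N →ₗ[k] A) : Prop :=
  ∃ g ginv, IsStabilityWitness μ f finv g ginv

end MeasCohomology

section SmashStatements

variable {k : Type} [Field k]
variable {T N H A : Type} [Ring T] [Bialgebra k T] [Ring N] [Bialgebra k N]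
  [Ring H] [Bialgebra k H] [CommRing A] [Algebra k A]

/-- `n ⊗ t ↦ (n ⋊ 1)(1 ⋊ t) = n ⋊ t`. -/
noncomputable def smashMul (iN : N →ₐc[k] H) (iT : T →ₐc[k] H) : N ⊗[k] T →ₗ[k] H :=
  LinearMap.mul' k H ∘ₗ TensorProduct.map iN.toLinearMap iT.toLinearMap

/-- The restriction of a 2-cochain on `H` to `N ⊗ N`. -/
noncomputable def resNN (iN : N →ₐc[k] H) (f : H ⊗[k] H →ₗ[k] A) : N ⊗[k] N →ₗ[k] A :=
  f ∘ₗ TensorProduct.map iN.toLinearMap iN.toLinearMap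

/-- The restriction of a 2-cochain on `H` to `T ⊗ T`. -/
noncomputable def resTT (iT : T →ₐc[k] H) (f : H ⊗[k] H →ₗ[k] A) : T ⊗[k] T →ₗ[k] A :=
  f ∘ₗ TensorProduct.map iT.toLinearMap iT.toLinearMap

/-- The restriction of a 2-cochain on `H` to `T ⊗ N`. -/
noncomputable def resTN (iN : N →ₐc[k] H) (iT : T →ₐc[k] H) (f : H ⊗[k] H →ₗ[k] A) :
    T ⊗[k] N →ₗ[k] A :=
  f ∘ₗ TensorProduct.map iT.toLinearMap iN.toLinearMap

/-- `f` is trivial on `N ⊗ T`: `f(n ⊗ t) = ε(n)ε(t)1`. -/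
def TrivialOnNT (iN : N →ₐc[k] H) (iT : T →ₐc[k] H) (f : H ⊗[k] H →ₗ[k] A) : Prop :=
  ∀ (n : N) (t : T), f (iN n ⊗ₜ[k] iT t)
    = algebraMap k A (Coalgebra.counit n * Coalgebra.counit t)

/-- `f` is trivial on `T ⊗ T`. -/
def TrivialOnTT (iT : T →ₐc[k] H) (f : H ⊗[k] H →ₗ[k] A) : Prop :=
  ∀ t t' : T, f (iT t ⊗ₜ[k] iT t')
    = algebraMap k A (Coalgebra.counit t * Coalgebra.counit t')

/-- `F` is the 2-cochain `ι f : (n ⋊ t) ⊗ (n' ⋊ t') ↦ ε(n) f(t)(n') ε(t')` on `H`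
associated with a measuring 1-cochain `f`. -/
def IotaOf (iN : N →ₐc[k] H) (iT : T →ₐc[k] H) (f : T ⊗[k] N →ₗ[k] A)
    (F : H ⊗[k] H →ₗ[k] A) : Prop :=
  ∀ (n : N) (t : T) (n' : N) (t' : T),
    F ((iN n * iT t) ⊗ₜ[k] (iN n' * iT t'))
      = algebraMap k A (Coalgebra.counit n * Coalgebra.counit t') * f (t ⊗ₜ[k] n')

/-- `J` is the 3-cochain
`jf : (n⋊t) ⊗ (n'⋊t') ⊗ (n''⋊t'') ↦ ε(n)ε(n') f(t⊗t')(n'') ε(t'')` on `H`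
associated with a measuring 2-cochain `f`. -/
def JOf (iN : N →ₐc[k] H) (iT : T →ₐc[k] H) (f : (T ⊗[k] T) ⊗[k] N →ₗ[k] A)
    (J : (H ⊗[k] H) ⊗[k] H →ₗ[k] A) : Prop :=
  ∀ (n : N) (t : T) (n' : N) (t' : T) (n'' : N) (t'' : T),
    J (((iN n * iT t) ⊗ₜ[k] (iN n' * iT t')) ⊗ₜ[k] (iN n'' * iT t''))
      = algebraMap k A (Coalgebra.counit n * Coalgebra.counit n' * Coalgebra.counit t'')
          * f ((t ⊗ₜ[k] t') ⊗ₜ[k] n'')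

end SmashStatements

end SmashPaper

open TensorProduct SmashPaper


section UniversalMeasuring

variable {k : Type} [Field k]
variable {N A : Type} [Ring N] [Bialgebra k N] [CommRing A] [Algebra k A]

/-- `(M, θ)` is a universal measuring coalgebra of `N` to `A`: it measures `N` to `A`,
and every measuring `(C, f)` factors through it by a unique coalgebra map. -/
structure IsUniversalMeasuring (M : Type) [AddCommGroup M] [Module k M] [Coalgebra k M]
    (θ : M ⊗[k] N →ₗ[k] A) : Prop where
  meas : Measures θ
  univ : ∀ (C : Type) [AddCommGroup C] [Module k C] [Coalgebra k C],
    ∀ f : C ⊗[k] N →ₗ[k] A, Measures f →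
      ∃! φ : C →ₗc[k] M, f = θ ∘ₗ LinearMap.rTensor N φ.toLinearMap

variable {M : Type} [AddCommGroup M] [Module k M] [Coalgebra k M]

/-- The measuring `ω : (M ⊗ M) ⊗ N → A`, `ω(f ⊗ g ⊗ n) = ∑ θ(f ⊗ n₍₁₎) θ(g ⊗ n₍₂₎)`. -/
noncomputable def mulMeasuring (θ : M ⊗[k] N →ₗ[k] A) : (M ⊗[k] M) ⊗[k] N →ₗ[k] A :=
  LinearMap.mul' k A ∘ₗ TensorProduct.map θ θ
    ∘ₗ (TensorProduct.tensorTensorTensorComm k M M N N).toLinearMap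
    ∘ₗ LinearMap.lTensor (M ⊗[k] M) Coalgebra.comul

/-- Convolution of two maps with values in `M`, with respect to a multiplication
map `m` on `M`. -/
noncomputable def mconv {C : Type} [AddCommGroup C] [Module k C] [Coalgebra k C]
    (m : M ⊗[k] M →ₗ[k] M) (f g : C →ₗ[k] M) : C →ₗ[k] M :=
  m ∘ₗ TensorProduct.map f g ∘ₗ Coalgebra.comul

end UniversalMeasuring

section CommutativeQuotient

open Coalgebra WithConv

variable {k : Type} [Field k]

theorem TensorProduct.eq_zero_of_forall_mul'_map_eq_zero {V : Type} [AddCommGroup V] [Module k V]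
    {S : Set (V →ₗ[k] k)} (hS : ∀ v, (∀ s ∈ S, s v = 0) → v = 0) {z : V ⊗[k] V}
    (hz : ∀ s ∈ S, ∀ s' ∈ S, LinearMap.mul' k k (TensorProduct.map s s' z) = 0) : z = 0 := by
  have key : ∀ (s s' : V →ₗ[k] k) (z : V ⊗[k] V), s' (TensorProduct.lid k V
      (LinearMap.rTensor V s z)) = LinearMap.mul' k k (TensorProduct.map s s' z) := by
    intro s s' z
    induction z with
    | zero => simp
    | add x y hx hy => simp only [map_add, hx, hy]
    | tmul x y => simp
  have h1 : ∀ s ∈ S, TensorProduct.lid k V (LinearMap.rTensor V s z) = 0 := fun s hs =>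
    hS _ fun s' hs' => by rw [key, hz s hs s' hs']
  classical
  let b := Module.Basis.ofVectorSpace k V
  have h2 : ∀ (s : V →ₗ[k] k) (z : V ⊗[k] V) i,
      s (TensorProduct.equivFinsuppOfBasisRight b z i) =
        b.repr (TensorProduct.lid k V (LinearMap.rTensor V s z)) i := by
    intro s z i
    induction z with
    | zero => simp
    | add x y hx hy => simp only [map_add, Finsupp.add_apply, hx, hy]
    | tmul x y => simp [mul_comm]
  apply (TensorProduct.equivFinsuppOfBasisRight (M := V) b).injective
  ext i
  rw [map_zero, Finsupp.zero_apply]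
  exact hS _ fun s hs => by rw [h2, h1 s hs, map_zero, Finsupp.zero_apply]

variable {C : Type} [AddCommGroup C] [Module k C] [Coalgebra k C]

/-- The subspace of a coalgebra annihilated by a subalgebra of its convolution dual. -/
def convAnnihilator (S : Subalgebra k (WithConv (C →ₗ[k] k))) : Submodule k C :=
  ⨅ s ∈ S, LinearMap.ker s.ofConv

theorem mem_convAnnihilator {S : Subalgebra k (WithConv (C →ₗ[k] k))} {c : C} :
    c ∈ convAnnihilator S ↔ ∀ s ∈ S, s c = 0 := by
  simp [convAnnihilator]

theorem convAnnihilator_separating (S : Subalgebra k (WithConv (C →ₗ[k] k)))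
    (v : C ⧸ convAnnihilator S)
    (hv : ∀ r ∈ {r : (C ⧸ convAnnihilator S) →ₗ[k] k |
      toConv (r ∘ₗ (convAnnihilator S).mkQ) ∈ S}, r v = 0) : v = 0 := by
  obtain ⟨c, rfl⟩ := Submodule.mkQ_surjective _ v
  rw [Submodule.mkQ_apply, Submodule.Quotient.mk_eq_zero, mem_convAnnihilator]
  intro s hs
  have hle : convAnnihilator S ≤ LinearMap.ker s.ofConv :=
    fun x hx => mem_convAnnihilator.1 hx s hs
  exact hv ((convAnnihilator S).liftQ s.ofConv hle) (by
    rwa [Set.mem_ofPred_eq, Submodule.liftQ_mkQ])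

instance convAnnihilator_isCoideal (S : Subalgebra k (WithConv (C →ₗ[k] k))) :
    (convAnnihilator S).IsCoideal where
  counit_eq_zero x hx := mem_convAnnihilator.1 hx 1 S.one_mem
  map_mkQ_comul_eq_zero x hx := by
    refine TensorProduct.eq_zero_of_forall_mul'_map_eq_zero (convAnnihilator_separating S)
      fun r hr r' hr' => ?_
    rw [← mem_convAnnihilator.1 hx _ (S.mul_mem hr hr'), LinearMap.convMul_apply,
      ← LinearMap.comp_apply (TensorProduct.map r r'), ← TensorProduct.map_comp]

theorem isCocomm_quotient_convAnnihilator (S : Subalgebra k (WithConv (C →ₗ[k] k)))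
    (hS : ∀ s ∈ S, ∀ s' ∈ S, s * s' = s' * s) :
    Coalgebra.IsCocomm k (C ⧸ convAnnihilator S) where
  comm_comp_comul := by
    ext c
    refine sub_eq_zero.1 (TensorProduct.eq_zero_of_forall_mul'_map_eq_zero
      (convAnnihilator_separating S) fun r hr r' hr' => ?_)
    have h := congr($(hS _ hr _ hr') c)
    simp only [LinearMap.convMul_apply] at h
    have key : ∀ z : C ⊗[k] C, LinearMap.mul' k k (TensorProduct.map r r'
        (TensorProduct.comm k _ _ (TensorProduct.map (convAnnihilator S).mkQ
          (convAnnihilator S).mkQ z))) = LinearMap.mul' k k (TensorProduct.map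
            (r' ∘ₗ (convAnnihilator S).mkQ) (r ∘ₗ (convAnnihilator S).mkQ) z) := by
      intro z
      induction z with
      | zero => simp
      | add x y hx hy => simp only [map_add, hx, hy]
      | tmul x y => simp [mul_comm]
    simp only [LinearMap.comp_apply, LinearEquiv.coe_coe, Submodule.mkQ_apply,
      Coalgebra.Quotient.comul_mk, map_sub, key, ← h]
    rw [← LinearMap.comp_apply (TensorProduct.map r r'), ← TensorProduct.map_comp, sub_self]

end CommutativeQuotient

section Measuring

open Coalgebra WithConv

variable {k : Type} [Field k]
variable {C D : Type} [AddCommGroup C] [Module k C] [Coalgebra k C]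
  [AddCommGroup D] [Module k D] [Coalgebra k D]
variable {N : Type} [Ring N] [Bialgebra k N]
variable {A : Type} [CommRing A] [Algebra k A]

/-- The linear map `θ(- ⊗ n)`, as an element of a convolution algebra. -/
noncomputable def sliceConv {C N R : Type} [AddCommGroup C] [Module k C] [AddCommGroup N]
    [Module k N] [AddCommGroup R] [Module k R] (θ : C ⊗[k] N →ₗ[k] R) (n : N) :
    WithConv (C →ₗ[k] R) :=
  toConv (θ ∘ₗ (TensorProduct.mk k C N).flip n)

theorem map_dropR_dropL_comul (a b : N) :
    TensorProduct.map (dropR N N) (dropL N N) (comul (R := k) (a ⊗ₜ[k] b)) = a ⊗ₜ b := by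
  have h : ∀ y z : N ⊗[k] N, TensorProduct.map (dropR N N) (dropL N N)
      (TensorProduct.tensorTensorTensorComm k N N N N (y ⊗ₜ z)) =
      dropR N N y ⊗ₜ[k] dropL N N z := by
    intro y z
    induction y with
    | zero => simp
    | add x y hx hy => simp only [map_add, TensorProduct.add_tmul, hx, hy]
    | tmul a b =>
      induction z with
      | zero => simp
      | add x y hx hy => simp only [map_add, TensorProduct.tmul_add, hx, hy]
      | tmul c d => simp [dropL, dropR, ← TensorProduct.smul_tmul', smul_smul, mul_comm]
  rw [TensorProduct.comul_tmul]
  erw [h]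
  simp [dropL, dropR]

theorem map_dropL_dropR_comul (a b : N) :
    TensorProduct.map (dropL N N) (dropR N N) (comul (R := k) (a ⊗ₜ[k] b)) = b ⊗ₜ a := by
  have h : ∀ y z : N ⊗[k] N, TensorProduct.map (dropL N N) (dropR N N)
      (TensorProduct.tensorTensorTensorComm k N N N N (y ⊗ₜ z)) =
      dropR N N z ⊗ₜ[k] dropL N N y := by
    intro y z
    induction y with
    | zero => simp
    | add x y hx hy => simp only [map_add, TensorProduct.add_tmul, TensorProduct.tmul_add, hx, hy]
    | tmul a b =>
      induction z with
      | zero => simp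
      | add x y hx hy =>
        simp only [map_add, TensorProduct.add_tmul, TensorProduct.tmul_add, hx, hy]
      | tmul c d => simp [dropL, dropR, ← TensorProduct.smul_tmul', smul_smul, mul_comm]
  rw [TensorProduct.comul_tmul]
  erw [h]
  simp [dropL, dropR]

theorem convMul_comp_lTensor_apply {R : Type} [Ring R] [Algebra k R] (F G : C ⊗[k] N →ₗ[k] R)
    {p q : N ⊗[k] N →ₗ[k] N} {x : N ⊗[k] N} {n n' : N}
    (hx : TensorProduct.map p q (comul (R := k) x) = n ⊗ₜ[k] n') (c : C) :
    (toConv (F ∘ₗ LinearMap.lTensor C p) * toConv (G ∘ₗ LinearMap.lTensor C q)) (c ⊗ₜ[k] x) =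
      (sliceConv F n * sliceConv G n') c := by
  have h : ∀ (y : C ⊗[k] C) (z : (N ⊗[k] N) ⊗[k] (N ⊗[k] N)),
      TensorProduct.map (F ∘ₗ LinearMap.lTensor C p) (G ∘ₗ LinearMap.lTensor C q)
        (TensorProduct.tensorTensorTensorComm k C C (N ⊗[k] N) (N ⊗[k] N) (y ⊗ₜ z)) =
      TensorProduct.map F G (TensorProduct.tensorTensorTensorComm k C C N N
        (y ⊗ₜ TensorProduct.map p q z)) := by
    intro y z
    induction y with
    | zero => simp
    | add x y hx hy => simp only [map_add, TensorProduct.add_tmul, hx, hy]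
    | tmul a b =>
      induction z with
      | zero => simp
      | add x y hx hy => simp only [map_add, TensorProduct.tmul_add, hx, hy]
      | tmul c d => simp
  rw [LinearMap.convMul_apply, TensorProduct.comul_tmul]
  erw [h]
  rw [hx, LinearMap.convMul_apply]
  generalize comul (R := k) c = z
  induction z with
  | zero => simp
  | add x y hx hy => simp only [map_add, TensorProduct.add_tmul, hx, hy]
  | tmul a b => simp [sliceConv]

theorem measures_iff (θ : C ⊗[k] N →ₗ[k] A) :
    Measures θ ↔ (∀ n n', sliceConv θ (n * n') = sliceConv θ n * sliceConv θ n') ∧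
      sliceConv θ 1 = 1 := by
  have key : ∀ c n n', conv (θ ∘ₗ LinearMap.lTensor C (dropR N N))
      (θ ∘ₗ LinearMap.lTensor C (dropL N N)) (c ⊗ₜ[k] (n ⊗ₜ[k] n')) =
      (sliceConv θ n * sliceConv θ n') c := fun c n n' =>
    convMul_comp_lTensor_apply θ θ (map_dropR_dropL_comul n n') c
  refine and_congr ⟨fun h n n' => ?_, fun h => ?_⟩ ⟨fun h => ?_, fun h c => ?_⟩
  · ext c
    rw [← key, ← h]
    simp [sliceConv]
  · ext c n n'
    simpa [sliceConv, key] using congr($(h n n') c)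
  · ext c
    simpa [sliceConv] using h c
  · simpa [sliceConv] using congr($h c)

theorem sliceConv_comp_rTensor (θ : C ⊗[k] N →ₗ[k] A) (φ : D →ₗc[k] C) (n : N) :
    sliceConv (θ ∘ₗ LinearMap.rTensor N φ.toLinearMap) n =
      toConv ((sliceConv θ n).ofConv ∘ₗ φ.toLinearMap) := by
  ext; simp [sliceConv]

theorem SmashPaper.Measures.comp_rTensor {θ : C ⊗[k] N →ₗ[k] A} (hθ : Measures θ)
    (φ : D →ₗc[k] C) : Measures (θ ∘ₗ LinearMap.rTensor N φ.toLinearMap) := by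
  rw [measures_iff] at hθ ⊢
  simp only [sliceConv_comp_rTensor, hθ.1, hθ.2, LinearMap.convMul_comp_coalgHom_distrib,
    toConv_ofConv, implies_true, true_and]
  ext; simp

theorem SmashPaper.Measures.of_comp_rTensor {θ : C ⊗[k] N →ₗ[k] A} {φ : D →ₗc[k] C}
    (hφ : Function.Surjective φ) (h : Measures (θ ∘ₗ LinearMap.rTensor N φ.toLinearMap)) :
    Measures θ := by
  rw [measures_iff] at h ⊢
  simp only [sliceConv_comp_rTensor] at h
  refine ⟨fun n n' => ?_, ?_⟩
  · have := h.1 n n'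
    rw [← toConv_ofConv (toConv _ * toConv _), ← LinearMap.convMul_comp_coalgHom_distrib] at this
    ext c
    obtain ⟨d, rfl⟩ := hφ c
    exact congr($this d)
  · ext c
    obtain ⟨d, rfl⟩ := hφ c
    have h2 := h.2
    simpa using congr($h2 d)

theorem IsUniversalMeasuring.hom_ext {M : Type} [AddCommGroup M] [Module k M] [Coalgebra k M]
    {θ : M ⊗[k] N →ₗ[k] A} (hM : IsUniversalMeasuring M θ) {φ ψ : C →ₗc[k] M}
    (h : θ ∘ₗ LinearMap.rTensor N φ.toLinearMap = θ ∘ₗ LinearMap.rTensor N ψ.toLinearMap) :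
    φ = ψ :=
  (hM.univ C _ (hM.meas.comp_rTensor φ)).unique rfl h

end Measuring

section ModuleBialgebra

open Coalgebra WithConv HopfAlgebra

variable {k : Type} [Field k]

theorem CoalgHom.isUnit_toConv {C N : Type} [AddCommGroup C] [Module k C] [Coalgebra k C]
    [Ring N] [HopfAlgebra k N] (f : C →ₗc[k] N) : IsUnit (toConv f.toLinearMap) := by
  have key : ∀ g h : N →ₗ[k] N, toConv g * toConv h = 1 →
      toConv (g ∘ₗ f.toLinearMap) * toConv (h ∘ₗ f.toLinearMap) = 1 := by
    intro g h hgh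
    have := LinearMap.convMul_comp_coalgHom_distrib (toConv g) (toConv h) f
    rw [hgh] at this
    rw [← toConv_ofConv (toConv (g ∘ₗ _) * _), ← this]
    ext c
    simp
  exact ⟨⟨_, _, key _ _ LinearMap.id_mul_antipode, key _ _ LinearMap.antipode_mul_id⟩, rfl⟩

theorem isUnit_toConv_algHom_comp {C R R' : Type} [AddCommGroup C] [Module k C] [Coalgebra k C]
    [Ring R] [Algebra k R] [Ring R'] [Algebra k R'] {f : C →ₗ[k] R}
    (hf : IsUnit (toConv f)) (g : R →ₐ[k] R') : IsUnit (toConv (g.toLinearMap ∘ₗ f)) := by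
  have key : ∀ a b : WithConv (C →ₗ[k] R), a * b = 1 →
      toConv (g.toLinearMap ∘ₗ a.ofConv) * toConv (g.toLinearMap ∘ₗ b.ofConv) = 1 := by
    intro a b hab
    have := LinearMap.algHom_comp_convMul_distrib g a b
    rw [hab] at this
    rw [← toConv_ofConv (toConv (_ ∘ₗ _) * _), ← this]
    ext c
    simp
  obtain ⟨⟨a, b, hab, hba⟩, h⟩ := hf
  obtain rfl : a = toConv f := h
  exact ⟨⟨_, _, key _ _ hab, key _ _ hba⟩, rfl⟩

variable {T N : Type} [Ring T] [Bialgebra k T] [Ring N]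

/-- The action of a module bialgebra, as a coalgebra map. -/
noncomputable def SmashPaper.IsModuleBialgebra.coalgHom [Bialgebra k N] {μ : T ⊗[k] N →ₗ[k] N}
    (hμ : IsModuleBialgebra μ) : T ⊗[k] N →ₗc[k] N where
  toLinearMap := μ
  counit_comp := by
    ext t n
    simp [hμ.counit_act, mul_comm]
  map_comp_comul := by
    rw [hμ.comul_act]
    rfl

/-- `dropR` as a coalgebra map. -/
noncomputable def dropRCoalgHom [Bialgebra k N] : N ⊗[k] N →ₗc[k] N :=
  (Coalgebra.TensorProduct.rid k k N).toCoalgHom.comp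
    (CoalgHom.lTensor N (counitCoalgHom k N))

/-- `dropL` as a coalgebra map. -/
noncomputable def dropLCoalgHom [Bialgebra k N] : N ⊗[k] N →ₗc[k] N :=
  (Coalgebra.TensorProduct.lid k N).toCoalgHom.comp
    (CoalgHom.rTensor N (counitCoalgHom k N))

theorem SmashPaper.IsModuleBialgebra.sliceConv_mul [Bialgebra k N] {μ : T ⊗[k] N →ₗ[k] N}
    (hμ : IsModuleBialgebra μ) (n n' : N) :
    sliceConv μ (n * n') = sliceConv μ n * sliceConv μ n' := by
  ext t
  have h := LinearMap.congr_fun hμ.act_mul (t ⊗ₜ (n ⊗ₜ n'))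
  simp only [LinearMap.comp_apply, LinearMap.lTensor_tmul, LinearMap.mul'_apply,
    LinearMap.rTensor_tmul] at h
  rw [LinearMap.convMul_apply]
  refine h.trans ?_
  generalize comul (R := k) t = z
  induction z with
  | zero => simp
  | add x y hx hy => simp only [map_add, TensorProduct.add_tmul, hx, hy]
  | tmul a b => simp [sliceConv]

theorem Bialgebra.includeLeft_convMul_includeRight [Bialgebra k N] :
    toConv (Algebra.TensorProduct.includeLeft (R := k) (S := k) (A := N) (B := N)).toLinearMap *
      toConv (Algebra.TensorProduct.includeRight (R := k) (A := N) (B := N)).toLinearMap =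
        toConv (comul (R := k) (A := N)) := by
  ext n
  rw [LinearMap.convMul_apply]
  change _ = comul (R := k) n
  generalize comul (R := k) n = z
  induction z with
  | zero => simp
  | add x y hx hy => simp only [map_add, hx, hy]
  | tmul a b => simp

theorem SmashPaper.IsModuleBialgebra.sliceConv_comm [HopfAlgebra k N] {μ : T ⊗[k] N →ₗ[k] N}
    (hμ : IsModuleBialgebra μ) (n n' : N) :
    sliceConv ((Algebra.TensorProduct.includeLeft (R := k) (S := k) (A := N)
        (B := N)).toLinearMap ∘ₗ μ) n' *
      sliceConv ((Algebra.TensorProduct.includeRight (R := k) (A := N)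
        (B := N)).toLinearMap ∘ₗ μ) n =
    sliceConv ((Algebra.TensorProduct.includeRight (R := k) (A := N)
        (B := N)).toLinearMap ∘ₗ μ) n *
      sliceConv ((Algebra.TensorProduct.includeLeft (R := k) (S := k) (A := N)
        (B := N)).toLinearMap ∘ₗ μ) n' := by
  set I₁ := Algebra.TensorProduct.includeLeft (R := k) (S := k) (A := N) (B := N)
  set I₂ := Algebra.TensorProduct.includeRight (R := k) (A := N) (B := N)
  let p₁ := hμ.coalgHom.comp (CoalgHom.lTensor T (dropRCoalgHom (k := k) (N := N)))
  let p₂ := hμ.coalgHom.comp (CoalgHom.lTensor T (dropLCoalgHom (k := k) (N := N)))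
  let pm := hμ.coalgHom.comp (CoalgHom.lTensor T (Bialgebra.mulCoalgHom k N))
  have hpm : toConv pm.toLinearMap = toConv p₁.toLinearMap * toConv p₂.toLinearMap := by
    ext t a b
    refine Eq.trans ?_ (convMul_comp_lTensor_apply μ μ (map_dropR_dropL_comul a b) t).symm
    rw [← hμ.sliceConv_mul]
    rfl
  have hsplit : ∀ f : T ⊗[k] (N ⊗[k] N) →ₗc[k] N,
      toConv (comul (R := k) ∘ₗ f.toLinearMap) =
        toConv (I₁.toLinearMap ∘ₗ f.toLinearMap) * toConv (I₂.toLinearMap ∘ₗ f.toLinearMap) := by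
    intro f
    have := LinearMap.convMul_comp_coalgHom_distrib (toConv I₁.toLinearMap)
      (toConv I₂.toLinearMap) f
    rw [Bialgebra.includeLeft_convMul_includeRight] at this
    exact congr(toConv $this)
  have hdist : ∀ I : N →ₐ[k] N ⊗[k] N, toConv (I.toLinearMap ∘ₗ pm.toLinearMap) =
      toConv (I.toLinearMap ∘ₗ p₁.toLinearMap) * toConv (I.toLinearMap ∘ₗ p₂.toLinearMap) := by
    intro I
    have := LinearMap.algHom_comp_convMul_distrib I (toConv p₁.toLinearMap)
      (toConv p₂.toLinearMap)
    rw [← hpm] at this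
    exact congr(toConv $this)
  have h := hdist (Bialgebra.comulAlgHom k N)
  have h1 : (Bialgebra.comulAlgHom k N).toLinearMap = comul := rfl
  rw [h1, hsplit, hsplit, hsplit, hdist, hdist, mul_assoc, mul_assoc,
    (isUnit_toConv_algHom_comp p₁.isUnit_toConv I₁).mul_right_inj, ← mul_assoc, ← mul_assoc,
    (isUnit_toConv_algHom_comp p₂.isUnit_toConv I₂).mul_left_inj] at h
  ext t
  have e1 := convMul_comp_lTensor_apply (I₁.toLinearMap ∘ₗ μ) (I₂.toLinearMap ∘ₗ μ)
    (map_dropL_dropR_comul n n') t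
  have e2 := convMul_comp_lTensor_apply (I₂.toLinearMap ∘ₗ μ) (I₁.toLinearMap ∘ₗ μ)
    (map_dropR_dropL_comul n n') t
  rw [← e1, ← e2]
  have e3 := LinearMap.congr_fun congr(ofConv $h) (t ⊗ₜ (n ⊗ₜ n'))
  exact e3

/-- The functional `φ(μ(- ⊗ n))` in the convolution algebra of `T`. -/
noncomputable def actionCoeff [Bialgebra k N] (μ : T ⊗[k] N →ₗ[k] N) (φ : Module.Dual k N)
    (n : N) : WithConv (T →ₗ[k] k) :=
  sliceConv (φ ∘ₗ μ) n

theorem SmashPaper.IsModuleBialgebra.actionCoeff_comm [HopfAlgebra k N] {μ : T ⊗[k] N →ₗ[k] N}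
    (hμ : IsModuleBialgebra μ) (φ φ' : Module.Dual k N) (n n' : N) :
    actionCoeff μ φ n * actionCoeff μ φ' n' = actionCoeff μ φ' n' * actionCoeff μ φ n := by
  ext t
  have h := congr(LinearMap.mul' k k (TensorProduct.map φ φ' ($(hμ.sliceConv_comm n' n) t)))
  simp only [LinearMap.convMul_apply] at h ⊢
  have key₁ : ∀ z : T ⊗[k] T, LinearMap.mul' k k (TensorProduct.map φ φ' (LinearMap.mul' k _
      (TensorProduct.map (sliceConv ((Algebra.TensorProduct.includeLeft (R := k) (S := k) (A := N)
        (B := N)).toLinearMap ∘ₗ μ) n).ofConv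
          (sliceConv ((Algebra.TensorProduct.includeRight (R := k) (A := N)
        (B := N)).toLinearMap ∘ₗ μ) n').ofConv z))) = LinearMap.mul' k k
          (TensorProduct.map (actionCoeff μ φ n).ofConv (actionCoeff μ φ' n').ofConv z) := by
    intro z
    induction z with
    | zero => simp
    | add x y hx hy => simp only [map_add, hx, hy]
    | tmul a b => simp [sliceConv, actionCoeff]
  have key₂ : ∀ z : T ⊗[k] T, LinearMap.mul' k k (TensorProduct.map φ φ' (LinearMap.mul' k _
      (TensorProduct.map (sliceConv ((Algebra.TensorProduct.includeRight (R := k) (A := N)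
        (B := N)).toLinearMap ∘ₗ μ) n').ofConv
          (sliceConv ((Algebra.TensorProduct.includeLeft (R := k) (S := k) (A := N)
        (B := N)).toLinearMap ∘ₗ μ) n).ofConv z))) = LinearMap.mul' k k
          (TensorProduct.map (actionCoeff μ φ' n').ofConv (actionCoeff μ φ n).ofConv z) := by
    intro z
    induction z with
    | zero => simp
    | add x y hx hy => simp only [map_add, hx, hy]
    | tmul a b => simp [sliceConv, actionCoeff, mul_comm]
  rwa [key₁, key₂] at h

/-- The action of a Hopf module bialgebra factors through a cocommutative quotient coalgebra. -/
theorem SmashPaper.IsModuleBialgebra.exists_isCocomm_quotient [HopfAlgebra k N]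
    {μ : T ⊗[k] N →ₗ[k] N} (hμ : IsModuleBialgebra μ) :
    ∃ (I : Submodule k T) (_ : I.IsCoideal), Coalgebra.IsCocomm k (T ⧸ I) ∧
      ∃ μ' : (T ⧸ I) ⊗[k] N →ₗ[k] N, μ' ∘ₗ LinearMap.rTensor N I.mkQ = μ := by
  let s : Set (WithConv (T →ₗ[k] k)) := {f | ∃ φ n, f = actionCoeff μ φ n}
  let S := Algebra.adjoin k s
  have hS : ∀ f ∈ S, ∀ g ∈ S, f * g = g * f := by
    intro f hf g hg
    refine Algebra.commute_of_mem_adjoin_of_forall_mem_commute hg fun b hb => Commute.symm ?_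
    refine Algebra.commute_of_mem_adjoin_of_forall_mem_commute hf fun a ha => ?_
    obtain ⟨φ, n, rfl⟩ := ha
    obtain ⟨φ', n', rfl⟩ := hb
    exact hμ.actionCoeff_comm _ _ _ _
  have hker : convAnnihilator S ≤ LinearMap.ker (TensorProduct.curry μ) := by
    intro t ht
    ext n
    refine (Module.forall_dual_apply_eq_zero_iff k _).1 fun φ => ?_
    exact mem_convAnnihilator.1 ht _ (Algebra.subset_adjoin ⟨φ, n, rfl⟩)
  refine ⟨convAnnihilator S, inferInstance, isCocomm_quotient_convAnnihilator S hS,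
    TensorProduct.lift ((convAnnihilator S).liftQ _ hker), ?_⟩
  ext t n
  simp

variable {A : Type} [CommRing A] [Algebra k A]
variable {M : Type} [AddCommGroup M] [Module k M] [Coalgebra k M]

theorem SmashPaper.Measures.comp_action [Bialgebra k N] {θ : M ⊗[k] N →ₗ[k] A} (hθ : Measures θ)
    {μ : T ⊗[k] N →ₗ[k] N} (hμ : IsModuleBialgebra μ) :
    Measures (θ ∘ₗ LinearMap.lTensor M μ ∘ₗ (TensorProduct.assoc k M T N).toLinearMap) := by
  rw [measures_iff] at hθ ⊢
  set θ' := θ ∘ₗ LinearMap.lTensor M μ ∘ₗ (TensorProduct.assoc k M T N).toLinearMap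
  have hθ' : ∀ n x t, sliceConv θ' n (x ⊗ₜ t) = sliceConv θ (μ (t ⊗ₜ n)) x := fun _ _ _ => rfl
  constructor
  · intro n n'
    ext x t
    have key : ∀ z : T ⊗[k] T, LinearMap.mul' k A (TensorProduct.map (sliceConv θ' n).ofConv
        (sliceConv θ' n').ofConv (TensorProduct.tensorTensorTensorComm k M M T T
          (comul (R := k) x ⊗ₜ z))) = θ (x ⊗ₜ LinearMap.mul' k N (TensorProduct.map
            (sliceConv μ n).ofConv (sliceConv μ n').ofConv z)) := by
      intro z
      induction z with
      | zero => simp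
      | add x y hx hy => simp only [map_add, TensorProduct.tmul_add, hx, hy]
      | tmul a b =>
        have h := LinearMap.congr_fun congr(ofConv $(hθ.1 (μ (a ⊗ₜ n)) (μ (b ⊗ₜ n')))) x
        refine Eq.trans ?_ (h.symm.trans rfl)
        change _ = LinearMap.mul' k A (TensorProduct.map _ _ (comul (R := k) x))
        generalize comul (R := k) x = y
        induction y with
        | zero => simp
        | add x y hx hy => simp only [map_add, TensorProduct.add_tmul, hx, hy]
        | tmul x y => simp [sliceConv, θ']
    have h := LinearMap.congr_fun congr(ofConv $(hμ.sliceConv_mul n n')) t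
    change sliceConv θ (μ (t ⊗ₜ (n * n'))) x = LinearMap.mul' k A (TensorProduct.map _ _
      (comul (R := k) (x ⊗ₜ[k] t)))
    rw [TensorProduct.comul_tmul]
    refine Eq.trans ?_ (key (comul (R := k) t)).symm
    exact congr(θ (x ⊗ₜ $h))
  · ext x t
    change θ (x ⊗ₜ μ (t ⊗ₜ 1)) = _
    have h := LinearMap.congr_fun congr(ofConv $(hθ.2)) x
    change θ (x ⊗ₜ 1) = algebraMap k A (counit x) at h
    rw [hμ.act_one, Algebra.algebraMap_eq_smul_one, TensorProduct.tmul_smul, map_smul, h]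
    change _ = algebraMap k A (counit (x ⊗ₜ[k] t))
    simp [Algebra.smul_def]

/-- The interchange of the middle factors, as a coalgebra map. -/
noncomputable def CoalgHom.tensorTensorTensorComm (C D E F : Type) [AddCommGroup C] [Module k C]
    [Coalgebra k C] [AddCommGroup D] [Module k D] [Coalgebra k D] [AddCommGroup E] [Module k E]
    [Coalgebra k E] [AddCommGroup F] [Module k F] [Coalgebra k F] :
    (C ⊗[k] D) ⊗[k] (E ⊗[k] F) →ₗc[k] (C ⊗[k] E) ⊗[k] (D ⊗[k] F) where
  toLinearMap := (TensorProduct.tensorTensorTensorComm k C D E F).toLinearMap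
  counit_comp := by
    ext
    simp
    ring
  map_comp_comul := by
    ext x y z w
    simp
    hopf_tensor_induction comul (R := k) x with x₁ x₂
    hopf_tensor_induction comul (R := k) y with y₁ y₂
    hopf_tensor_induction comul (R := k) z with z₁ z₂
    hopf_tensor_induction comul (R := k) w with w₁ w₂
    simp

theorem SmashPaper.IsModuleBialgebra.bar_comp_mul [HopfAlgebra k N]
    {μ : T ⊗[k] N →ₗ[k] N} (hμ : IsModuleBialgebra μ) {θ : M ⊗[k] N →ₗ[k] A}
    (hM : IsUniversalMeasuring M θ) (m : M ⊗[k] M →ₗc[k] M)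
    (hm : θ ∘ₗ LinearMap.rTensor N m.toLinearMap = mulMeasuring θ) {μbar : M ⊗[k] T →ₗc[k] M}
    (h : θ ∘ₗ LinearMap.rTensor N μbar.toLinearMap
      = θ ∘ₗ LinearMap.lTensor M μ ∘ₗ (TensorProduct.assoc k M T N).toLinearMap) :
    μbar.toLinearMap ∘ₗ LinearMap.rTensor T m.toLinearMap
      = m.toLinearMap ∘ₗ TensorProduct.map μbar.toLinearMap μbar.toLinearMap
        ∘ₗ (TensorProduct.tensorTensorTensorComm k M M T T).toLinearMap
        ∘ₗ LinearMap.lTensor (M ⊗[k] M) Coalgebra.comul := by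
  have hbar : ∀ x t n, θ (μbar (x ⊗ₜ t) ⊗ₜ n) = θ (x ⊗ₜ μ (t ⊗ₜ n)) := fun x t n =>
    LinearMap.congr_fun h ((x ⊗ₜ t) ⊗ₜ n)
  obtain ⟨I, _, _, μ', hμ'⟩ := hμ.exists_isCocomm_quotient
  let q : M ⊗[k] T →ₗc[k] M ⊗[k] (T ⧸ I) :=
    CoalgHom.lTensor M (Coalgebra.Quotient.mkQCoalgHom (R := k) I)
  let θ' := θ ∘ₗ LinearMap.lTensor M μ' ∘ₗ (TensorProduct.assoc k M (T ⧸ I) N).toLinearMap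
  have hθ' : θ' ∘ₗ LinearMap.rTensor N q.toLinearMap =
      θ ∘ₗ LinearMap.lTensor M μ ∘ₗ (TensorProduct.assoc k M T N).toLinearMap := by
    ext x t n
    exact congr(θ (x ⊗ₜ $(LinearMap.congr_fun hμ' (t ⊗ₜ n))))
  have hq : Function.Surjective q := LinearMap.lTensor_surjective M I.mkQ_surjective
  obtain ⟨ν, hν, -⟩ := hM.univ _ θ' (.of_comp_rTensor hq (hθ' ▸ hM.meas.comp_action hμ))
  have hνq : μbar = ν.comp q := by
    refine hM.hom_ext (h.trans (hθ'.symm.trans ?_))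
    rw [hν]
    ext x t n
    rfl
  let Φ : (M ⊗[k] M) ⊗[k] T →ₗc[k] M := m.comp ((Coalgebra.TensorProduct.map ν ν).comp
    ((CoalgHom.tensorTensorTensorComm M M (T ⧸ I) (T ⧸ I)).comp
      ((CoalgHom.lTensor (M ⊗[k] M) (comulCoalgHom k (T ⧸ I))).comp
        (CoalgHom.lTensor (M ⊗[k] M) (Coalgebra.Quotient.mkQCoalgHom (R := k) I)))))
  have hΦ : Φ.toLinearMap = m.toLinearMap ∘ₗ TensorProduct.map μbar.toLinearMap μbar.toLinearMap
      ∘ₗ (TensorProduct.tensorTensorTensorComm k M M T T).toLinearMap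
      ∘ₗ LinearMap.lTensor (M ⊗[k] M) Coalgebra.comul := by
    ext x y t
    change m (TensorProduct.map ν.toLinearMap ν.toLinearMap
      (TensorProduct.tensorTensorTensorComm k M M _ _ ((x ⊗ₜ y) ⊗ₜ
        TensorProduct.map I.mkQ I.mkQ (comul (R := k) t)))) =
      m (TensorProduct.map μbar.toLinearMap μbar.toLinearMap
      (TensorProduct.tensorTensorTensorComm k M M _ _ ((x ⊗ₜ y) ⊗ₜ comul (R := k) t)))
    generalize comul (R := k) t = z
    induction z with
    | zero => simp
    | add x y hx hy => simp only [map_add, TensorProduct.tmul_add, hx, hy]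
    | tmul a b => rw [hνq]; rfl
  rw [← hΦ]
  suffices μbar.comp (CoalgHom.rTensor T m) = Φ from congr(($this).toLinearMap)
  refine hM.hom_ext ?_
  rw [hΦ]
  ext x y t n
  have hm' : ∀ z n, θ (m z ⊗ₜ n) = LinearMap.mul' k A (TensorProduct.map θ θ
      (TensorProduct.tensorTensorTensorComm k M M N N (z ⊗ₜ comul (R := k) n))) := fun z n =>
    LinearMap.congr_fun hm (z ⊗ₜ n)
  change θ (μbar (m (x ⊗ₜ y) ⊗ₜ t) ⊗ₜ n) = θ (m (TensorProduct.map μbar.toLinearMap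
    μbar.toLinearMap (TensorProduct.tensorTensorTensorComm k M M T T ((x ⊗ₜ y) ⊗ₜ
      comul (R := k) t))) ⊗ₜ n)
  have hc : comul (R := k) (μ (t ⊗ₜ n)) = TensorProduct.map μ μ
      (TensorProduct.tensorTensorTensorComm k T T N N (comul (R := k) t ⊗ₜ comul (R := k) n)) :=
    LinearMap.congr_fun hμ.comul_act (t ⊗ₜ n)
  rw [hbar, hm', hm', hc]
  generalize comul (R := k) t = z
  generalize comul (R := k) n = w
  induction z with
  | zero => simp
  | add x y hx hy => simp only [map_add, TensorProduct.tmul_add, TensorProduct.add_tmul, hx, hy]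
  | tmul a b =>
    induction w with
    | zero => simp
    | add x y hx hy => simp only [map_add, TensorProduct.tmul_add, hx, hy]
    | tmul c d => simp [hbar]

end ModuleBialgebra

/-- **Proposition (`M(N,A)` is a right `T`-module bialgebra).**
Let `T` be a Hopf algebra over `k`, `N` a left `T`-module bialgebra via
`μ : T ⊗ N → N`, `A` a commutative `k`-algebra, and `(M, θ)` a universal measuring
coalgebra of `N` to `A` with its Hopf algebra structure (multiplication `m`, unit `η`).
Then there is a unique coalgebra map `μ̄ : M ⊗ T → M`, `f ⊗ t ↦ fᵗ`, with
`θ(fᵗ ⊗ n) = θ(f ⊗ t(n))`; and `μ̄` is a right `T`-module structure making `M` a right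
`T`-module bialgebra: `(fg)ᵗ = ∑ f^{t₍₁₎} g^{t₍₂₎}` and `1ᵗ = ε(t)1`. -/
theorem universal_measuring_module_bialgebra
    {k : Type} [Field k] {T N A : Type}
    [Ring T] [HopfAlgebra k T] [Ring N] [HopfAlgebra k N]
    [CommRing A] [Algebra k A]
    (μ : T ⊗[k] N →ₗ[k] N) (hμ : IsModuleBialgebra μ)
    {M : Type} [AddCommGroup M] [Module k M] [Coalgebra k M]
    (θ : M ⊗[k] N →ₗ[k] A) (hM : IsUniversalMeasuring M θ)
    (m : M ⊗[k] M →ₗc[k] M)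
    (hm : θ ∘ₗ LinearMap.rTensor N m.toLinearMap = mulMeasuring θ)
    (η : k →ₗc[k] M)
    (hη : ∀ n : N, θ (η 1 ⊗ₜ[k] n) = algebraMap k A (Coalgebra.counit n)) :
    -- unique coalgebra map `μ̄` with `θ(fᵗ ⊗ n) = θ(f ⊗ t(n))`
    (∃! μbar : M ⊗[k] T →ₗc[k] M,
      θ ∘ₗ LinearMap.rTensor N μbar.toLinearMap
        = θ ∘ₗ LinearMap.lTensor M μ ∘ₗ (TensorProduct.assoc k M T N).toLinearMap)
    -- and any such `μ̄` makes `M` a right `T`-module bialgebra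
    ∧ (∀ μbar : M ⊗[k] T →ₗc[k] M,
        θ ∘ₗ LinearMap.rTensor N μbar.toLinearMap
          = θ ∘ₗ LinearMap.lTensor M μ ∘ₗ (TensorProduct.assoc k M T N).toLinearMap →
        -- right module axioms
        (∀ (x : M) (t s : T), μbar (x ⊗ₜ[k] (t * s)) = μbar (μbar (x ⊗ₜ[k] t) ⊗ₜ[k] s))
        ∧ (∀ x : M, μbar (x ⊗ₜ[k] (1 : T)) = x)
        -- module-algebra compatibility `(fg)ᵗ = ∑ f^{t₍₁₎} g^{t₍₂₎}`
        ∧ (μbar.toLinearMap ∘ₗ LinearMap.rTensor T m.toLinearMap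
            = m.toLinearMap ∘ₗ TensorProduct.map μbar.toLinearMap μbar.toLinearMap
                ∘ₗ (TensorProduct.tensorTensorTensorComm k M M T T).toLinearMap
                ∘ₗ LinearMap.lTensor (M ⊗[k] M) Coalgebra.comul)
        -- unit compatibility `1ᵗ = ε(t) 1`
        ∧ (∀ t : T, μbar (η 1 ⊗ₜ[k] t) = Coalgebra.counit (R := k) t • η 1)) := by
  have hμbar : ∀ (μbar : M ⊗[k] T →ₗc[k] M),
      θ ∘ₗ LinearMap.rTensor N μbar.toLinearMap
        = θ ∘ₗ LinearMap.lTensor M μ ∘ₗ (TensorProduct.assoc k M T N).toLinearMap →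
      ∀ x t n, θ (μbar (x ⊗ₜ t) ⊗ₜ n) = θ (x ⊗ₜ μ (t ⊗ₜ n)) := fun μbar h x t n =>
    LinearMap.congr_fun h ((x ⊗ₜ t) ⊗ₜ n)
  refine ⟨?_, fun μbar h => ⟨fun x t s => ?_, fun x => ?_, ?_, fun t => ?_⟩⟩
  · obtain ⟨φ, h, huniq⟩ := hM.univ _ _ (hM.meas.comp_action hμ)
    exact ⟨φ, h.symm, fun ψ hψ => huniq ψ hψ.symm⟩
  · have e : μbar.comp (CoalgHom.lTensor M (Bialgebra.mulCoalgHom k T)) =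
        (μbar.comp (CoalgHom.rTensor T μbar)).comp
          (Coalgebra.TensorProduct.assoc k k M T T).symm.toCoalgHom := by
      refine hM.hom_ext ?_
      ext x t s n
      change θ (μbar (x ⊗ₜ (t * s)) ⊗ₜ n) = θ (μbar (μbar (x ⊗ₜ t) ⊗ₜ s) ⊗ₜ n)
      rw [hμbar _ h, hμbar _ h, hμbar _ h, hμ.mul_act]
    exact congr($e (x ⊗ₜ (t ⊗ₜ s)))
  · have e : (μbar.comp (CoalgHom.lTensor M (Bialgebra.unitBialgHom k T : k →ₗc[k] T))).comp
        (Coalgebra.TensorProduct.rid k k M).symm.toCoalgHom = CoalgHom.id k M := by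
      refine hM.hom_ext ?_
      ext x n
      change θ (μbar (x ⊗ₜ algebraMap k T 1) ⊗ₜ n) = θ (x ⊗ₜ n)
      rw [hμbar _ h, map_one, hμ.one_act]
    refine Eq.trans ?_ congr($e x)
    change μbar (x ⊗ₜ 1) = μbar (x ⊗ₜ algebraMap k T 1)
    rw [map_one]
  · exact hμ.bar_comp_mul hM m hm h
  · have e : (μbar.comp (CoalgHom.rTensor T η)).comp
        (Coalgebra.TensorProduct.lid k T).symm.toCoalgHom =
        η.comp (Coalgebra.counitCoalgHom k T) := by
      refine hM.hom_ext ?_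
      ext t n
      change θ (μbar (η 1 ⊗ₜ t) ⊗ₜ n) = θ (η (Coalgebra.counit t) ⊗ₜ n)
      have hε : η (Coalgebra.counit t) = Coalgebra.counit (R := k) t • η 1 := by
        rw [← map_smul, smul_eq_mul, mul_one]
      rw [hμbar _ h, hη, hμ.counit_act, hε, ← TensorProduct.smul_tmul', map_smul, hη, map_mul,
        Algebra.smul_def]
    refine congr($e t).trans ?_
    change η (Coalgebra.counit t) = _
    rw [← map_smul, smul_eq_mul, mul_one]
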